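/- For all integers k ≥ 2 and j ≥ 0, setting a = 2k+1+3j, the ℝ-vector space of derivations in D_0(f_{j,k}) that are homogeneous of degree d has dimension 0 for every d < a, and dimension (k+1)·(d−a+2)(d−a+1)/2 − (k−1)·(d−a+1)(d−a)/2 for every d ≥ a. In particular D_0(f_{j,k}) contains no nonzero homogeneous derivation of degree less than 2k+1+3j, and exactly a (k+1)-dimensional space of them in degree 2k+1+3j. -/

import Mathlib

open MvPolynomial

noncomputable section

abbrev S := MvPolynomial (Fin 3) ℝ

/-- Defining polynomial of the cone over `A_{A2}^{[-j, k+j]}`. -/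
def fjk (j k : ℕ) : S :=
  X 2 * ∏ s ∈ Finset.Icc (-(j : ℤ)) ((k : ℤ) + j),
    ((X 0 - C (s : ℝ) * X 2) * (X 1 - C (s : ℝ) * X 2) * (X 0 + X 1 - C (s : ℝ) * X 2))

/-- The ℝ-subspace of `D_0(f)` consisting of derivations homogeneous of degree `d`. -/
def homogD0 (f : S) (d : ℕ) : Submodule ℝ (Derivation ℝ S S) where
  carrier := {θ | θ f = 0 ∧ ∀ i : Fin 3, (θ (X i)).IsHomogeneous d}
  zero_mem' := by
    refine ⟨by simp, fun i => ?_⟩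
    simpa using isHomogeneous_zero (Fin 3) ℝ d
  add_mem' := by
    rintro a b ⟨ha0, ha⟩ ⟨hb0, hb⟩
    refine ⟨by simp [ha0, hb0], fun i => ?_⟩
    simpa using (ha i).add (hb i)
  smul_mem' := by
    rintro c θ ⟨h0, h⟩
    refine ⟨by simp [h0], fun i => ?_⟩
    have : (c • θ) (X i) = C c * θ (X i) := by
      simp [smul_eq_C_mul]
    rw [this]
    simpa using (isHomogeneous_C (Fin 3) c).mul (h i)

abbrev R2 := MvPolynomial (Fin 2) ℝ

/-- Polynomials in two variables of total degree `< n`. -/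
def PP (n : ℕ) : Submodule ℝ R2 := restrictSupport ℝ {m : Fin 2 →₀ ℕ | m.degree < n}

def idx (n : ℕ) : Finset (ℕ × ℕ) :=
  (Finset.range n ×ˢ Finset.range n).filter (fun p => p.1 + p.2 < n)

lemma mem_idx {n : ℕ} {p : ℕ × ℕ} : p ∈ idx n ↔ p.1 + p.2 < n := by
  simp only [idx, Finset.mem_filter, Finset.mem_product, Finset.mem_range]
  omega

lemma two_card_idx (n : ℕ) : 2 * (idx n).card = n * (n + 1) := by
  have h : idx n = (Finset.range n).biUnion (fun i => Finset.HasAntidiagonal.antidiagonal i) := by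
    ext p
    simp [mem_idx]
  rw [h, Finset.card_biUnion]
  · simp only [Finset.Nat.card_antidiagonal]
    have := Finset.sum_range_id_mul_two (n + 1)
    rw [Finset.sum_range_succ'] at this
    simp at this
    rw [mul_comm, this, mul_comm]
  · intro i _ i' _ hne
    simp only [Function.onFun]
    rw [Finset.disjoint_left]
    intro p hp hp'
    rw [Finset.HasAntidiagonal.mem_antidiagonal] at hp hp'
    omega

lemma mem_PP {n : ℕ} {p : R2} : p ∈ PP n ↔ p = 0 ∨ p.totalDegree < n := by
  rw [PP, mem_restrictSupport_iff]
  constructor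
  · intro h
    by_cases hp : p = 0
    · exact Or.inl hp
    · right
      have hne : p.support.Nonempty := by
        rwa [Finset.nonempty_iff_ne_empty, Ne, MvPolynomial.support_eq_empty]
      obtain ⟨m, hm, hmd⟩ := Finset.exists_mem_eq_sup p.support hne (fun s => s.sum fun _ e => e)
      have := h (Finset.mem_coe.2 hm)
      rw [totalDegree, hmd]
      exact this
  · rintro (rfl | h)
    · simp
    · intro m hm
      have := le_totalDegree (Finset.mem_coe.1 hm)
      simp only [Set.mem_ofPred_eq, Finsupp.degree, Finsupp.sum] at this ⊢
      exact lt_of_le_of_lt this h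

lemma PP_zero {p : R2} (h : p ∈ PP 0) : p = 0 := by
  rcases mem_PP.1 h with h | h
  · exact h
  · omega

lemma PP_mono {n n' : ℕ} (hn : n ≤ n') {p : R2} (h : p ∈ PP n) : p ∈ PP n' := by
  rcases mem_PP.1 h with h | h
  · exact mem_PP.2 (Or.inl h)
  · exact mem_PP.2 (Or.inr (by omega))

lemma mul_mem_PP {f q : R2} {m n : ℕ} (hf : f.totalDegree ≤ m) (h : q ∈ PP n) :
    f * q ∈ PP (m + n) := by
  rcases mem_PP.1 h with h | h
  · simp [h]
  · refine mem_PP.2 (Or.inr ?_)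
    have := totalDegree_mul f q
    omega

lemma mem_PP_of_mul {f q : R2} {m n : ℕ} (hf0 : f ≠ 0) (hf : f.totalDegree = m)
    (h : f * q ∈ PP n) : q ∈ PP (n - m) := by
  by_cases hq : q = 0
  · simp [hq]
  rcases mem_PP.1 h with h | h
  · simp [hf0, hq] at h
  · rw [totalDegree_mul_of_isDomain hf0 hq] at h
    exact mem_PP.2 (Or.inr (by omega))

def idxEquiv (n : ℕ) : {m : Fin 2 →₀ ℕ | m.degree < n} ≃ idx n where
  toFun m := ⟨(m.1 0, m.1 1), by
    have := m.2
    simp only [Set.mem_ofPred_eq, Finsupp.degree_eq_sum, Fin.sum_univ_two] at this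
    exact mem_idx.2 this⟩
  invFun p := ⟨Finsupp.equivFunOnFinite.symm ![p.1.1, p.1.2], by
    have := mem_idx.1 p.2
    simpa [Finsupp.degree_eq_sum, Fin.sum_univ_two] using this⟩
  left_inv m := by
    ext i
    fin_cases i <;> simp
  right_inv p := by
    ext <;> simp

instance finite_PP (n : ℕ) : Module.Finite ℝ (PP n) :=
  haveI : Finite {m : Fin 2 →₀ ℕ | m.degree < n} := Finite.of_equiv _ (idxEquiv n).symm
  Module.Finite.of_basis (basisRestrictSupport ℝ {m : Fin 2 →₀ ℕ | m.degree < n})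

lemma finrank_PP (n : ℕ) : Module.finrank ℝ (PP n) = (idx n).card := by
  have h := Module.finrank_eq_nat_card_basis
    (basisRestrictSupport ℝ {m : Fin 2 →₀ ℕ | m.degree < n})
  have h2 := Nat.card_congr (idxEquiv n)
  rw [Nat.card_eq_fintype_card (α := idx n), Fintype.card_coe] at h2
  exact h.trans h2

/-- falling factorial -/
def ff {A : Type*} [CommRing A] (x : A) (a : ℕ) : A := ∏ i ∈ Finset.range a, (x - (i : A))

lemma ff_add (x : ℝ) (a b : ℕ) : ff x (a + b) = ff x a * ff (x - a) b := by
  simp only [ff, Finset.prod_range_add]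
  congr 1
  apply Finset.prod_congr rfl
  intro i _
  push_cast
  ring

lemma ff_nat_eq_zero {n a : ℕ} (h : n < a) : ff (n : ℝ) a = 0 :=
  Finset.prod_eq_zero (Finset.mem_range.2 h) (sub_self _)

lemma ff_nat_ne_zero {n a : ℕ} (h : a ≤ n) : ff (n : ℝ) a ≠ 0 := by
  refine Finset.prod_ne_zero_iff.2 fun i hi => ?_
  rw [Finset.mem_range] at hi
  rw [sub_ne_zero]
  exact_mod_cast (by omega : n ≠ i)

def nw (p : ℕ × ℕ) : R2 := ff (X 0) p.1 * ff (X 1) p.2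

lemma eval_nw (x : Fin 2 → ℝ) (p : ℕ × ℕ) : eval x (nw p) = ff (x 0) p.1 * ff (x 1) p.2 := by
  simp [nw, ff, map_prod]

lemma ff_totalDegree (i : Fin 2) (a : ℕ) : (ff (X i : R2) a).totalDegree ≤ a := by
  refine (totalDegree_finsetProd _ _).trans ?_
  refine (Finset.sum_le_card_nsmul _ _ 1 ?_).trans (by simp)
  intro s _
  have := totalDegree_sub_C_le (X i : R2) (s : ℝ)
  simpa using this

lemma nw_mem_PP {n : ℕ} {p : ℕ × ℕ} (h : p.1 + p.2 < n) : nw p ∈ PP n := by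
  refine mem_PP.2 (Or.inr ?_)
  have := totalDegree_mul (ff (X 0 : R2) p.1) (ff (X 1) p.2)
  have h1 := ff_totalDegree 0 p.1
  have h2 := ff_totalDegree 1 p.2
  unfold nw
  omega

/-- triangularity -/
lemma coeff_zero_of_eval (J : Finset (ℕ × ℕ)) (c : ℕ × ℕ → ℝ) (N : ℕ)
    (h : ∀ a b : ℕ, a + b < N → eval ![(a : ℝ), (b : ℝ)] (∑ p ∈ J, c p • nw p) = 0) :
    ∀ n, ∀ p ∈ J, p.1 + p.2 = n → n < N → c p = 0 := by
  intro n
  induction n using Nat.strong_induction_on with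
  | _ n ih =>
    intro p hp hpn hnN
    have h1 := h p.1 p.2 (by omega)
    rw [map_sum, Finset.sum_eq_single p] at h1
    · rw [smul_eval, eval_nw] at h1
      simpa [ff_nat_ne_zero le_rfl] using h1
    · intro q hq hqp
      rw [smul_eval, eval_nw]
      by_cases h1 : p.1 < q.1
      · simp [ff_nat_eq_zero h1]
      by_cases h2 : p.2 < q.2
      · simp [ff_nat_eq_zero h2]
      have : q.1 + q.2 < n := by
        by_contra hcon
        exact hqp (Prod.ext (by omega) (by omega))
      rw [ih _ this q hq rfl (by omega), zero_mul]
    · intro h; exact absurd hp h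

def nwMap (J : Finset (ℕ × ℕ)) : (J → ℝ) →ₗ[ℝ] R2 where
  toFun c := ∑ p, c p • nw p.1
  map_add' c c' := by simp [add_smul, Finset.sum_add_distrib]
  map_smul' r c := by simp [mul_smul, Finset.smul_sum]

lemma nwMap_apply (J : Finset (ℕ × ℕ)) (c : J → ℝ) : nwMap J c = ∑ p, c p • nw p.1 := rfl

open Classical in
lemma nwMap_ext (J : Finset (ℕ × ℕ)) (c : J → ℝ) :
    nwMap J c = ∑ p ∈ J, (if h : p ∈ J then c ⟨p, h⟩ else 0) • nw p := by
  rw [nwMap_apply, ← Finset.sum_coe_sort J]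
  apply Finset.sum_congr rfl
  intro p _
  simp

lemma nwMap_zero (J : Finset (ℕ × ℕ)) (c : J → ℝ) (N : ℕ)
    (h : ∀ a b : ℕ, a + b < N → eval ![(a : ℝ), (b : ℝ)] (nwMap J c) = 0)
    (p : J) (hp : p.1.1 + p.1.2 < N) : c p = 0 := by
  classical
  rw [nwMap_ext] at h
  have := coeff_zero_of_eval J _ N h _ p.1 p.2 rfl hp
  simpa using this

lemma nwMap_injective (J : Finset (ℕ × ℕ)) : Function.Injective (nwMap J) := by
  rw [injective_iff_map_eq_zero]
  intro c hc
  ext p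
  exact nwMap_zero J c (p.1.1 + p.1.2 + 1) (by simp [hc]) p (by omega)

lemma nwMap_mem {J : Finset (ℕ × ℕ)} {n : ℕ} (hJ : ∀ p ∈ J, p.1 + p.2 < n) (c : J → ℝ) :
    nwMap J c ∈ PP n :=
  Submodule.sum_mem _ fun p _ => Submodule.smul_mem _ _ (nw_mem_PP (hJ p.1 p.2))

lemma nwMap_surj (n : ℕ) {p : R2} (hp : p ∈ PP n) : ∃ c, nwMap (idx n) c = p := by
  let g : (idx n → ℝ) →ₗ[ℝ] PP n :=
    (nwMap (idx n)).codRestrict (PP n) (nwMap_mem fun p hp => mem_idx.1 hp)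
  have hg : Function.Injective g := by
    intro a b hab
    exact nwMap_injective _ (congrArg Subtype.val hab)
  have hr : Module.finrank ℝ (idx n → ℝ) = Module.finrank ℝ (PP n) := by
    rw [finrank_PP]; simp
  obtain ⟨c, hc⟩ := (LinearMap.injective_iff_surjective_of_finrank_eq_finrank hr).1 hg ⟨p, hp⟩
  exact ⟨c, congrArg Subtype.val hc⟩
lemma evalM (M : ℝ) (J : Finset (ℕ × ℕ)) (c : J → ℝ) (a b : ℕ) :
    ff M a * ff M b * eval ![M - a, M - b] (nwMap J c) =
      ∑ q : J, (ff M (a + q.1.1) * ff M (b + q.1.2)) * c q := by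
  rw [nwMap_apply, map_sum, Finset.mul_sum]
  apply Finset.sum_congr rfl
  intro q _
  rw [smul_eval, eval_nw, ff_add, ff_add]
  simp
  ring

def VV (N j n : ℕ) : Submodule ℝ R2 where
  carrier := {C | C ∈ PP n ∧ (∀ a b : ℕ, a + b < N → eval ![(a : ℝ), (b : ℝ)] C = 0) ∧
    (∀ a b : ℕ, a + b < j → eval ![((N + j : ℕ) : ℝ) - a, ((N + j : ℕ) : ℝ) - b] C = 0)}
  zero_mem' := by simp
  add_mem' := by
    rintro p q ⟨h1, h2, h3⟩ ⟨h1', h2', h3'⟩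
    refine ⟨add_mem h1 h1', fun a b h => ?_, fun a b h => ?_⟩
    · rw [map_add, h2 a b h, h2' a b h, add_zero]
    · rw [map_add, h3 a b h, h3' a b h, add_zero]
  smul_mem' := by
    rintro c p ⟨h1, h2, h3⟩
    refine ⟨Submodule.smul_mem _ _ h1, fun a b h => ?_, fun a b h => ?_⟩
    · rw [smul_eval, h2 a b h, mul_zero]
    · rw [smul_eval, h3 a b h, mul_zero]

def JJ (N n : ℕ) : Finset (ℕ × ℕ) := (idx n).filter (fun p => N ≤ p.1 + p.2)

lemma mem_JJ {N n : ℕ} {p : ℕ × ℕ} : p ∈ JJ N n ↔ p.1 + p.2 < n ∧ N ≤ p.1 + p.2 := by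
  simp [JJ, mem_idx]

lemma card_JJ {N n : ℕ} (h : N ≤ n) : (JJ N n).card + (idx N).card = (idx n).card := by
  have h2 : (idx n).filter (fun p => ¬ N ≤ p.1 + p.2) = idx N := by
    ext p; simp only [Finset.mem_filter, mem_idx]; omega
  rw [← h2, JJ]
  exact Finset.card_filter_add_card_filter_not _

def KK (N j n : ℕ) : Matrix (idx j) (JJ N n) ℝ := fun p q =>
  ff ((N + j : ℕ) : ℝ) (p.1.1 + q.1.1) * ff ((N + j : ℕ) : ℝ) (p.1.2 + q.1.2)

lemma VV_eq (N j n : ℕ) :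
    VV N j n = (LinearMap.ker (KK N j n).mulVecLin).map (nwMap (JJ N n)) := by
  ext C
  constructor
  · rintro ⟨h1, h2, h3⟩
    obtain ⟨c, rfl⟩ := nwMap_surj n h1
    have hc := nwMap_zero (idx n) c N h2
    have hJ : ∀ q ∈ JJ N n, q ∈ idx n := fun q hq => (Finset.mem_filter.1 hq).1
    let c' : JJ N n → ℝ := fun q => c ⟨q.1, hJ q.1 q.2⟩
    have heq : nwMap (JJ N n) c' = nwMap (idx n) c := by
      classical
      rw [nwMap_ext, nwMap_ext]
      have : ∀ p ∈ idx n, p ∉ JJ N n →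
          (if h : p ∈ idx n then c ⟨p, h⟩ else 0) • nw p = 0 := by
        intro p hp hp'
        rw [dif_pos hp, hc, zero_smul]
        simp only [mem_JJ, mem_idx] at hp hp' ⊢
        omega
      rw [← Finset.sum_subset hJ this]
      apply Finset.sum_congr rfl
      intro p hp
      rw [dif_pos hp, dif_pos (hJ p hp)]
    refine ⟨c', ?_, heq⟩
    rw [SetLike.mem_coe, LinearMap.mem_ker]
    ext p
    have := evalM ((N + j : ℕ) : ℝ) (JJ N n) c' p.1.1 p.1.2
    rw [heq, h3 _ _ (mem_idx.1 p.2), mul_zero] at this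
    simpa [Matrix.mulVec, dotProduct, KK] using this.symm
  · rintro ⟨c, hc, rfl⟩
    refine ⟨nwMap_mem (fun p hp => (mem_JJ.1 hp).1) c, ?_, ?_⟩
    · intro a b hab
      rw [nwMap_apply, map_sum]
      apply Finset.sum_eq_zero
      intro q _
      have := (mem_JJ.1 q.2).2
      rw [smul_eval, eval_nw]
      by_cases h1 : a < q.1.1
      · simp [ff_nat_eq_zero h1]
      · have h2 : b < q.1.2 := by omega
        simp [ff_nat_eq_zero h2]
    · intro a b hab
      rw [SetLike.mem_coe, LinearMap.mem_ker] at hc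
      have h1 := congrFun hc ⟨(a, b), mem_idx.2 hab⟩
      have h2 := evalM ((N + j : ℕ) : ℝ) (JJ N n) c a b
      have h3 : ∑ q : JJ N n, (ff ((N + j : ℕ) : ℝ) (a + q.1.1) *
          ff ((N + j : ℕ) : ℝ) (b + q.1.2)) * c q = 0 := by
        simpa [Matrix.mulVec, dotProduct, KK] using h1
      rw [h3] at h2
      have ha : ff ((N + j : ℕ) : ℝ) a ≠ 0 := ff_nat_ne_zero (by omega)
      have hb : ff ((N + j : ℕ) : ℝ) b ≠ 0 := ff_nat_ne_zero (by omega)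
      exact (mul_eq_zero.1 h2).resolve_left (mul_ne_zero ha hb)

/-- A linear polynomial through a substitution divides the difference. -/
lemma dvd_sub_aeval {σ : Type*} (α : MvPolynomial σ ℝ) (g : σ → MvPolynomial σ ℝ)
    (h : ∀ i, α ∣ X i - g i) (F : MvPolynomial σ ℝ) : α ∣ F - aeval g F := by
  induction F using MvPolynomial.induction_on with
  | C a => simp
  | add p q hp hq =>
    rw [map_add, add_sub_add_comm]
    exact dvd_add hp hq
  | mul_X p i hp =>
    rw [map_mul, aeval_X]
    have : p * X i - aeval g p * g i = (p - aeval g p) * X i + aeval g p * (X i - g i) := by ring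
    rw [this]
    exact dvd_add (hp.mul_right _) ((h i).mul_left _)

def ll (w : ℝ) : R2 := X 0 + X 1 - C w

lemma eval_ll (w : ℝ) (x : Fin 2 → ℝ) : eval x (ll w) = x 0 + x 1 - w := by simp [ll]

lemma ll_dvd {L : R2} {n : ℕ} (hL : L ∈ PP n) (w : ℝ) (T : Finset ℝ) (hT : n ≤ T.card)
    (h : ∀ t ∈ T, eval ![t, w - t] L = 0) : ll w ∣ L := by
  rcases mem_PP.1 hL with rfl | hd
  · simp
  let g : Polynomial ℝ := aeval ![Polynomial.X, Polynomial.C w - Polynomial.X] L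
  have hev : ∀ t, g.eval t = eval ![t, w - t] L := by
    intro t
    have : (Polynomial.aeval t).comp
      (aeval ![Polynomial.X, Polynomial.C w - Polynomial.X] : R2 →ₐ[ℝ] Polynomial ℝ) =
        (aeval ![t, w - t] : R2 →ₐ[ℝ] ℝ) := by
      ext i
      fin_cases i <;> simp
    have h2 := DFunLike.congr_fun this L
    simpa [g, Polynomial.coe_aeval_eq_eval, coe_aeval_eq_eval] using h2
  have hg : g = 0 := by
    apply Polynomial.eq_zero_of_natDegree_lt_card_of_eval_eq_zero' g T
    · intro t ht
      rw [hev, h t ht]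
    · refine lt_of_le_of_lt (aeval_natDegree_le (m := L.totalDegree) (n := 1) L le_rfl _ ?_) (by omega)
      intro i
      fin_cases i
      · simp
      · simp only [Fin.mk_one, Matrix.cons_val_one]
        exact (Polynomial.natDegree_sub_le _ _).trans (by simp)
  have hs : aeval ![X 0, C w - X 0] L = (0 : R2) := by
    have : (Polynomial.aeval (X 0 : R2)).comp
      (aeval ![Polynomial.X, Polynomial.C w - Polynomial.X] : R2 →ₐ[ℝ] Polynomial ℝ) =
        (aeval ![X 0, C w - X 0] : R2 →ₐ[ℝ] R2) := by
      ext i : 1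
      fin_cases i
      · simp
      · simp [MvPolynomial.algebraMap_eq]
    rw [← this, AlgHom.comp_apply]
    change Polynomial.aeval (X 0 : R2) g = 0
    rw [hg, map_zero]
  have := dvd_sub_aeval (ll w) ![X 0, C w - X 0] ?_ L
  · rwa [hs, sub_zero] at this
  · intro i
    fin_cases i
    · simp
    · refine ⟨1, ?_⟩
      simp [ll]; ring

lemma totalDegree_X_add_X_sub (w : ℝ) : (ll w).totalDegree = 1 := by
  apply le_antisymm
  · refine (totalDegree_sub_C_le _ _).trans ((totalDegree_add _ _).trans (by simp))
  · have h : Finsupp.single 0 1 ∈ (ll w).support := by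
      rw [mem_support_iff, ll]
      have h0 : (0 : Fin 2 →₀ ℕ) ≠ Finsupp.single 0 1 := by
        intro h
        have := DFunLike.congr_fun h 0
        simp at this
      simp [coeff_X, coeff_C, Finsupp.single_left_inj, h0]
    have := le_totalDegree h
    simpa using this

lemma ll_ne_zero (w : ℝ) : ll w ≠ 0 := by
  intro h
  have := totalDegree_X_add_X_sub w
  simp [h] at this

/-- product of lines -/
def PL (N j t : ℕ) : R2 := ∏ i ∈ Finset.range t, ll (2 * ((N + j : ℕ) : ℝ) - (N + i : ℕ))

lemma PL_ne_zero (N j t : ℕ) : PL N j t ≠ 0 := Finset.prod_ne_zero_iff.2 fun _ _ => ll_ne_zero _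

lemma PL_degree (N j t : ℕ) : (PL N j t).totalDegree = t := by
  induction t with
  | zero => simp [PL]
  | succ t ih =>
    have h : PL N j (t + 1) = PL N j t * ll (2 * ((N + j : ℕ) : ℝ) - (N + t : ℕ)) :=
      Finset.prod_range_succ _ _
    rw [h, totalDegree_mul_of_isDomain (PL_ne_zero _ _ _) (ll_ne_zero _), ih,
      totalDegree_X_add_X_sub]

lemma line_step (N j : ℕ) (hj : j ≤ N) (L : R2) (hL : L ∈ PP j) (R : ℕ)
    (h : ∀ a b : ℕ, a ≤ N + j → b ≤ N + j → N ≤ a + b → a + b < N + R →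
      eval ![((N + j : ℕ) : ℝ) - a, ((N + j : ℕ) : ℝ) - b] L = 0) :
    ∀ t ≤ R, ∃ L' ∈ PP (j - t), L = PL N j t * L' := by
  intro t
  induction t with
  | zero => intro _; exact ⟨L, hL, by simp [PL]⟩
  | succ t ih =>
    intro ht
    obtain ⟨L', hL', hLL⟩ := ih (by omega)
    by_cases hjt : j ≤ t
    · have : L' = 0 := PP_zero (by rwa [Nat.sub_eq_zero_of_le hjt] at hL')
      exact ⟨0, zero_mem _, by rw [hLL, this]; simp⟩
    have hd : ll (2 * ((N + j : ℕ) : ℝ) - (N + t : ℕ)) ∣ L' := by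
      refine ll_dvd hL' _ ((Finset.range (N + t + 1)).image (fun a : ℕ => ((N + j : ℕ) : ℝ) - a)) ?_ ?_
      · rw [Finset.card_image_of_injective, Finset.card_range]
        · omega
        · intro a b hab
          simpa using hab
      · intro x hx
        obtain ⟨a, ha, rfl⟩ := Finset.mem_image.1 hx
        rw [Finset.mem_range] at ha
        have h1 := h a (N + t - a) (by omega) (by omega) (by omega) (by omega)
        have h2 : 2 * ((N + j : ℕ) : ℝ) - (N + t : ℕ) - (((N + j : ℕ) : ℝ) - a) =
            ((N + j : ℕ) : ℝ) - (N + t - a : ℕ) := by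
          rw [Nat.cast_sub (by omega)]; ring
        rw [h2]
        rw [hLL, map_mul] at h1
        rcases mul_eq_zero.1 h1 with h1 | h1
        · exfalso
          rw [PL, map_prod, Finset.prod_eq_zero_iff] at h1
          obtain ⟨i, hi, h3⟩ := h1
          rw [Finset.mem_range] at hi
          rw [eval_ll, Nat.cast_sub (by omega)] at h3
          simp only [Matrix.cons_val_zero, Matrix.cons_val_one] at h3
          push_cast at h3
          have : (i : ℝ) = t := by linarith
          have : i = t := by exact_mod_cast this
          omega
        · exact h1
    obtain ⟨L'', rfl⟩ := hd
    refine ⟨L'', ?_, ?_⟩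
    · have := mem_PP_of_mul (ll_ne_zero _) (totalDegree_X_add_X_sub _) hL'
      rwa [Nat.sub_sub] at this
    · rw [hLL, PL, PL, Finset.prod_range_succ, mul_assoc]

lemma ker_transpose_eq (N j r : ℕ) (hj : j ≤ N) :
    (LinearMap.ker (KK N j (N + r + 1)).transpose.mulVecLin).map (nwMap (idx j)) =
      (PP (j - (r + 1))).map (LinearMap.mulLeft ℝ (PL N j (r + 1))) := by
  have key : ∀ (c : idx j → ℝ), c ∈ LinearMap.ker (KK N j (N + r + 1)).transpose.mulVecLin ↔
      ∀ a b : ℕ, N ≤ a + b → a + b < N + (r + 1) → ff ((N + j : ℕ) : ℝ) a * ff ((N + j : ℕ) : ℝ) b *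
        eval ![((N + j : ℕ) : ℝ) - a, ((N + j : ℕ) : ℝ) - b] (nwMap (idx j) c) = 0 := by
    intro c
    rw [LinearMap.mem_ker]
    constructor
    · intro hc a b h1 h2
      rw [evalM]
      have := congrFun hc ⟨(a, b), mem_JJ.2 ⟨by simp; omega, by simpa using h1⟩⟩
      simpa [Matrix.vecMul, dotProduct, KK, add_comm, mul_comm] using this
    · intro h
      ext q
      have h1 := mem_JJ.1 q.2
      have := h q.1.1 q.1.2 (by omega) (by omega)
      rw [evalM] at this
      simpa [Matrix.vecMul, dotProduct, KK, add_comm, mul_comm] using this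
  ext L
  constructor
  · rintro ⟨c, hc, rfl⟩
    rw [SetLike.mem_coe, key] at hc
    obtain ⟨L', hL', h⟩ := line_step N j hj (nwMap (idx j) c)
      (nwMap_mem (fun p hp => mem_idx.1 hp) c) (r + 1) (by
        intro a b ha hb h1 h2
        have := hc a b h1 h2
        have ha : ff ((N + j : ℕ) : ℝ) a ≠ 0 := ff_nat_ne_zero ha
        have hb : ff ((N + j : ℕ) : ℝ) b ≠ 0 := ff_nat_ne_zero hb
        exact (mul_eq_zero.1 this).resolve_left (mul_ne_zero ha hb)) (r + 1) le_rfl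
    exact ⟨L', hL', h.symm⟩
  · rintro ⟨L', hL', rfl⟩
    rw [LinearMap.mulLeft_apply]
    have hm : PL N j (r + 1) * L' ∈ PP j := by
      by_cases hr : j ≤ r + 1
      · rw [Nat.sub_eq_zero_of_le hr] at hL'
        simp [PP_zero hL']
      · have := mul_mem_PP (PL_degree N j (r + 1)).le hL'
        rwa [Nat.add_sub_cancel' (by omega)] at this
    obtain ⟨c, hc⟩ := nwMap_surj j hm
    refine ⟨c, ?_, hc⟩
    rw [SetLike.mem_coe, key]
    intro a b h1 h2
    have h3 : eval ![((N + j : ℕ) : ℝ) - a, ((N + j : ℕ) : ℝ) - b] (PL N j (r + 1)) = 0 := by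
      rw [PL, map_prod]
      refine Finset.prod_eq_zero (i := a + b - N) (Finset.mem_range.2 (by omega)) ?_
      rw [eval_ll, Nat.add_sub_cancel' h1]
      simp only [Matrix.cons_val_zero, Matrix.cons_val_one]
      push_cast
      ring
    rw [hc, map_mul, h3]
    simp

lemma finrank_map_of_inj {V W : Type*} [AddCommGroup V] [Module ℝ V] [AddCommGroup W] [Module ℝ W]
    (f : V →ₗ[ℝ] W) (hf : Function.Injective f) (p : Submodule ℝ V) :
    Module.finrank ℝ (p.map f) = Module.finrank ℝ p :=
  (LinearEquiv.finrank_eq (Submodule.equivMapOfInjective f hf p)).symm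

lemma mulLeft_inj {f : R2} (hf : f ≠ 0) : Function.Injective (LinearMap.mulLeft ℝ f) := by
  intro a b hab
  exact mul_left_cancel₀ hf hab

lemma finrank_VV (N j r : ℕ) (hj : j ≤ N) :
    Module.finrank ℝ (VV N j (N + r + 1)) + (idx j).card + (idx N).card =
      (idx (N + r + 1)).card + (idx (j - (r + 1))).card := by
  have h1 : Module.finrank ℝ (VV N j (N + r + 1)) =
      Module.finrank ℝ (LinearMap.ker (KK N j (N + r + 1)).mulVecLin) := by
    rw [VV_eq, finrank_map_of_inj _ (nwMap_injective _)]
  have h2 := LinearMap.finrank_range_add_finrank_ker (KK N j (N + r + 1)).mulVecLin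
  have h3 := LinearMap.finrank_range_add_finrank_ker (KK N j (N + r + 1)).transpose.mulVecLin
  have h4 := Matrix.rank_transpose (KK N j (N + r + 1))
  rw [Matrix.rank, Matrix.rank] at h4
  have h5 : Module.finrank ℝ (LinearMap.ker (KK N j (N + r + 1)).transpose.mulVecLin) =
      (idx (j - (r + 1))).card := by
    rw [← finrank_map_of_inj _ (nwMap_injective (idx j)), ker_transpose_eq N j r hj,
      finrank_map_of_inj _ (mulLeft_inj (PL_ne_zero _ _ _)), finrank_PP]
  have h6 := card_JJ (N := N) (n := N + r + 1) (by omega)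
  simp only [Module.finrank_fintype_fun_eq_card, Fintype.card_coe] at h2 h3
  omega
lemma dvd_of_subst {σ : Type*} {α F G : MvPolynomial σ ℝ} (g : σ → MvPolynomial σ ℝ)
    (h : ∀ i, α ∣ X i - g i) (hα : aeval g α = 0) (x : σ → ℝ) (hx : ∀ i, eval x (g i) = x i)
    (hF : eval x F ≠ 0) (hd : α ∣ F * G) : α ∣ G := by
  have h1 : aeval g F * aeval g G = 0 := by
    obtain ⟨H, hH⟩ := hd
    rw [← map_mul, hH, map_mul, hα, zero_mul]
  have h2 : eval x (aeval g F) = eval x F := by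
    have : (aeval x : MvPolynomial σ ℝ →ₐ[ℝ] ℝ).comp (aeval g) = aeval x := by
      ext i
      simp [hx]
    have := DFunLike.congr_fun this F
    simpa [coe_aeval_eq_eval] using this
  have h3 : aeval g F ≠ 0 := by
    intro h0
    rw [h0, map_zero] at h2
    exact hF h2.symm
  have h4 := (mul_eq_zero.1 h1).resolve_left h3
  have := dvd_sub_aeval α g h G
  rwa [h4, sub_zero] at this

lemma isCoprime_sub_C {σ : Type*} (l : MvPolynomial σ ℝ) {a b : ℝ} (h : a ≠ b) :
    IsCoprime (l - C a) (l - C b) := by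
  refine ⟨C (b - a)⁻¹, -C (b - a)⁻¹, ?_⟩
  have h1 : b - a ≠ 0 := sub_ne_zero.2 h.symm
  have : C (b - a)⁻¹ * (l - C a) + -C (b - a)⁻¹ * (l - C b) = C ((b - a)⁻¹ * (b - a)) := by
    simp only [C_mul, C_sub]; ring
  rw [this, inv_mul_cancel₀ h1, C_1]

lemma prod_degree (f : ℕ → R2) (h0 : ∀ i, f i ≠ 0) (h1 : ∀ i, (f i).totalDegree = 1) (t : ℕ) :
    (∏ i ∈ Finset.range t, f i).totalDegree = t := by
  induction t with
  | zero => simp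
  | succ t ih =>
    rw [Finset.prod_range_succ, totalDegree_mul_of_isDomain
      (Finset.prod_ne_zero_iff.2 fun _ _ => h0 _) (h0 _), ih, h1]

lemma totalDegree_X_sub_C' (i : Fin 2) (u : ℝ) : (X i - C u : R2).totalDegree = 1 := by
  apply le_antisymm
  · exact (totalDegree_sub_C_le _ _).trans (by simp)
  · have h : Finsupp.single i 1 ∈ (X i - C u : R2).support := by
      rw [mem_support_iff]
      have h0 : (0 : Fin 2 →₀ ℕ) ≠ Finsupp.single i 1 := by
        intro h
        have := DFunLike.congr_fun h i
        simp at this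
      simp [coeff_C, h0]
    have := le_totalDegree h
    simpa using this

lemma X_sub_C_ne_zero' (i : Fin 2) (u : ℝ) : (X i - C u : R2) ≠ 0 := by
  intro h
  have := totalDegree_X_sub_C' i u
  simp [h] at this

def PhX (i : Fin 2) (m : ℕ) : R2 := ∏ u ∈ Finset.range m, (X i - C (u : ℝ))

def PhL (N m : ℕ) : R2 := ∏ u ∈ Finset.range m, ll ((N + u : ℕ) : ℝ)

lemma PhX_ne (i m) : PhX i m ≠ 0 := Finset.prod_ne_zero_iff.2 fun _ _ => X_sub_C_ne_zero' _ _
lemma PhL_ne (N m) : PhL N m ≠ 0 := Finset.prod_ne_zero_iff.2 fun _ _ => ll_ne_zero _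
lemma PhX_deg (i m) : (PhX i m).totalDegree = m :=
  prod_degree _ (fun _ => X_sub_C_ne_zero' _ _) (fun _ => totalDegree_X_sub_C' _ _) m
lemma PhL_deg (N m) : (PhL N m).totalDegree = m :=
  prod_degree _ (fun _ => ll_ne_zero _) (fun _ => totalDegree_X_add_X_sub _) m

lemma PhX_dvd {i : Fin 2} {m : ℕ} {p : R2} (h : ∀ u < m, (X i - C (u : ℝ)) ∣ p) : PhX i m ∣ p := by
  apply Finset.prod_dvd_of_coprime
  · intro a _ b _ hab
    exact isCoprime_sub_C _ (by exact_mod_cast hab)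
  · intro u hu
    exact h u (Finset.mem_range.1 hu)

lemma PhL_dvd {N m : ℕ} {p : R2} (h : ∀ u < m, ll ((N + u : ℕ) : ℝ) ∣ p) : PhL N m ∣ p := by
  apply Finset.prod_dvd_of_coprime
  · intro a _ b _ hab
    refine isCoprime_sub_C _ ?_
    intro h
    have : N + a = N + b := by exact_mod_cast h
    omega
  · intro u hu
    exact h u (Finset.mem_range.1 hu)

def EE (N j d : ℕ) : Submodule ℝ (R2 × R2) where
  carrier := {x | x.1 ∈ PP (d + 1) ∧ x.2 ∈ PP (d + 1) ∧
    ∀ u < N + j + 1, (X 0 - C (u : ℝ)) ∣ x.1 ∧ (X 1 - C (u : ℝ)) ∣ x.2 ∧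
      ll ((N + u : ℕ) : ℝ) ∣ x.1 + x.2}
  zero_mem' := by simp
  add_mem' := by
    rintro x y ⟨h1, h2, h3⟩ ⟨h1', h2', h3'⟩
    refine ⟨add_mem h1 h1', add_mem h2 h2', fun u hu => ?_⟩
    obtain ⟨a, b, c⟩ := h3 u hu
    obtain ⟨a', b', c'⟩ := h3' u hu
    refine ⟨dvd_add a a', dvd_add b b', ?_⟩
    have : (x + y).1 + (x + y).2 = (x.1 + x.2) + (y.1 + y.2) := by
      simp only [Prod.fst_add, Prod.snd_add]; ring
    rw [this]
    exact dvd_add c c'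
  smul_mem' := by
    rintro r x ⟨h1, h2, h3⟩
    refine ⟨Submodule.smul_mem _ _ h1, Submodule.smul_mem _ _ h2, fun u hu => ?_⟩
    obtain ⟨a, b, c⟩ := h3 u hu
    refine ⟨?_, ?_, ?_⟩
    · simpa [smul_eq_C_mul] using a.mul_left _
    · simpa [smul_eq_C_mul] using b.mul_left _
    · have : (r • x).1 + (r • x).2 = C r * (x.1 + x.2) := by
        simp [smul_eq_C_mul, mul_add]
      rw [this]
      exact c.mul_left _

lemma EE_data {N j d : ℕ} {x : R2 × R2} (hx : x ∈ EE N j d) :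
    PhX 0 (N + j + 1) ∣ x.1 ∧ PhX 1 (N + j + 1) ∣ x.2 ∧
    ∃ Q ∈ VV N j (d + 1 - (N + j + 1)), x.1 + x.2 = PhL N (N + j + 1) * Q := by
  obtain ⟨h1, h2, h3⟩ := hx
  have d1 := PhX_dvd fun u hu => (h3 u hu).1
  have d2 := PhX_dvd fun u hu => (h3 u hu).2.1
  obtain ⟨Q, hQ⟩ := PhL_dvd fun u hu => (h3 u hu).2.2
  refine ⟨d1, d2, Q, ⟨?_, ?_, ?_⟩, hQ⟩
  · have := add_mem h1 h2
    rw [hQ] at this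
    exact mem_PP_of_mul (PhL_ne _ _) (PhL_deg _ _) this
  all_goals
    have grid : ∀ a b : ℕ, a < N + j + 1 → b < N + j + 1 →
        eval ![(a : ℝ), (b : ℝ)] (PhL N (N + j + 1)) * eval ![(a : ℝ), (b : ℝ)] Q = 0 := by
      intro a b ha hb
      rw [← map_mul, ← hQ, map_add]
      obtain ⟨c, hc⟩ := (h3 a ha).1
      obtain ⟨c', hc'⟩ := (h3 b hb).2.1
      rw [hc, hc']
      simp
    have nz : ∀ a b : ℕ, (a + b < N ∨ N + (N + j) < a + b) →
        eval ![(a : ℝ), (b : ℝ)] (PhL N (N + j + 1)) ≠ 0 := by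
      intro a b hab
      rw [PhL, map_prod]
      refine Finset.prod_ne_zero_iff.2 fun u hu => ?_
      rw [Finset.mem_range] at hu
      rw [eval_ll, sub_ne_zero]
      simp only [Matrix.cons_val_zero, Matrix.cons_val_one]
      intro h
      have : a + b = N + u := by exact_mod_cast h
      omega
    intro a b hab
  · exact (mul_eq_zero.1 (grid a b (by omega) (by omega))).resolve_left (nz a b (Or.inl hab))
  · have := (mul_eq_zero.1 (grid (N + j - a) (N + j - b) (by omega) (by omega))).resolve_left
      (nz _ _ (Or.inr (by omega)))
    rwa [Nat.cast_sub (by omega), Nat.cast_sub (by omega)] at this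

lemma VV_lift {N j d : ℕ} {Q : R2} (hQ : Q ∈ VV N j (d + 1 - (N + j + 1))) :
    ∃ x ∈ EE N j d, x.1 + x.2 = PhL N (N + j + 1) * Q := by
  obtain ⟨h1, h2, h3⟩ := hQ
  rcases mem_PP.1 h1 with rfl | hdeg
  · exact ⟨0, zero_mem _, by simp⟩
  let T : Finset ℝ := (Finset.range (N + j + 1)).image (fun a : ℕ => (a : ℝ))
  have hT : ∀ i : Fin 2, ∏ s ∈ T, (X i - C s) = PhX i (N + j + 1) := by
    intro i
    rw [Finset.prod_image]
    · rfl
    · intro a _ b _ h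
      exact Nat.cast_injective h
  obtain ⟨h, hh1, hh2⟩ := combinatorial_nullstellensatz_exists_linearCombination
    (fun _ : Fin 2 => T) (fun _ => ⟨0, Finset.mem_image.2 ⟨0, by simp, by simp⟩⟩)
    (PhL N (N + j + 1) * Q) (by
      intro x hx
      obtain ⟨a, ha, hxa⟩ := Finset.mem_image.1 (hx 0)
      obtain ⟨b, hb, hxb⟩ := Finset.mem_image.1 (hx 1)
      rw [Finset.mem_range] at ha hb
      have hxx : x = ![(a : ℝ), (b : ℝ)] := by
        ext i; fin_cases i <;> simp [hxa, hxb]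
      rw [hxx, map_mul]
      by_cases c1 : a + b < N
      · rw [h2 a b c1, mul_zero]
      by_cases c2 : N + (N + j) < a + b
      · have := h3 (N + j - a) (N + j - b) (by omega)
        rw [Nat.cast_sub (by omega), Nat.cast_sub (by omega)] at this
        rw [sub_sub_cancel, sub_sub_cancel] at this
        rw [this, mul_zero]
      · have : eval ![(a : ℝ), (b : ℝ)] (PhL N (N + j + 1)) = 0 := by
          rw [PhL, map_prod]
          refine Finset.prod_eq_zero (i := a + b - N) (Finset.mem_range.2 (by omega)) ?_
          rw [eval_ll, Nat.add_sub_cancel' (by omega)]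
          simp
        rw [this, zero_mul])
  simp only [hT] at hh1
  have hsum : PhX 0 (N + j + 1) * h 0 + PhX 1 (N + j + 1) * h 1 = PhL N (N + j + 1) * Q := by
    rw [hh2, Finsupp.linearCombination_apply, Finsupp.sum_fintype _ _ (by simp)]
    simp [Fin.sum_univ_two, hT, mul_comm]
  have htd : (PhL N (N + j + 1) * Q).totalDegree < d + 1 := by
    have := totalDegree_mul (PhL N (N + j + 1)) Q
    rw [PhL_deg] at this
    omega
  refine ⟨(PhX 0 (N + j + 1) * h 0, PhX 1 (N + j + 1) * h 1), ⟨?_, ?_, ?_⟩, hsum⟩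
  · exact mem_PP.2 (Or.inr (lt_of_le_of_lt (hh1 0) htd))
  · exact mem_PP.2 (Or.inr (lt_of_le_of_lt (hh1 1) htd))
  · intro u hu
    refine ⟨?_, ?_, ?_⟩
    · exact (Finset.dvd_prod_of_mem _ (Finset.mem_range.2 hu)).mul_right _
    · exact (Finset.dvd_prod_of_mem _ (Finset.mem_range.2 hu)).mul_right _
    · change _ ∣ PhX 0 (N + j + 1) * h 0 + PhX 1 (N + j + 1) * h 1
      rw [hsum]
      exact (Finset.dvd_prod_of_mem (fun u : ℕ => ll ((N + u : ℕ) : ℝ))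
        (Finset.mem_range.2 hu)).mul_right _

lemma EE_ker {N j d : ℕ} {x : R2 × R2} (hx : x ∈ EE N j d) (h0 : x.1 + x.2 = 0) :
    ∃ g ∈ PP (d + 1 - 2 * (N + j + 1)), x.1 = PhX 0 (N + j + 1) * PhX 1 (N + j + 1) * g := by
  obtain ⟨⟨g, hg⟩, hd2, -⟩ := EE_data hx
  have h1 : PhX 1 (N + j + 1) ∣ g := by
    apply PhX_dvd
    intro u hu
    refine dvd_of_subst (F := PhX 0 (N + j + 1)) ![X 0, C (u : ℝ)] ?_ (by simp) ![-1, (u : ℝ)] ?_ ?_ ?_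
    · intro i
      fin_cases i <;> simp
    · intro i
      fin_cases i <;> simp
    · rw [PhX, map_prod]
      refine Finset.prod_ne_zero_iff.2 fun v _ => ?_
      simp only [map_sub, eval_X, eval_C, Matrix.cons_val_zero]
      have : (0 : ℝ) ≤ v := Nat.cast_nonneg v
      intro h
      linarith
    · rw [← hg]
      have : x.1 = - x.2 := eq_neg_of_add_eq_zero_left h0
      rw [this, dvd_neg]
      exact (hx.2.2 u hu).2.1
  obtain ⟨g', rfl⟩ := h1
  refine ⟨g', ?_, by rw [hg, mul_assoc]⟩
  have h2 := hx.1
  rw [hg] at h2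
  have h3 := mem_PP_of_mul (PhX_ne _ _) (PhX_deg _ _) h2
  have h4 := mem_PP_of_mul (PhX_ne _ _) (PhX_deg _ _) h3
  rwa [Nat.sub_sub, ← two_mul] at h4

instance finite_EE (N j d : ℕ) : Module.Finite ℝ (EE N j d) := by
  let f : EE N j d →ₗ[ℝ] PP (d + 1) × PP (d + 1) :=
    { toFun := fun x => (⟨x.1.1, x.2.1⟩, ⟨x.1.2, x.2.2.1⟩)
      map_add' := fun x y => rfl
      map_smul' := fun r x => rfl }
  refine Module.Finite.of_injective f ?_
  intro x y h
  have h1 : x.1.1 = y.1.1 := congrArg (fun z => z.1.1) h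
  have h2 : x.1.2 = y.1.2 := congrArg (fun z => z.2.1) h
  exact Subtype.ext (Prod.ext h1 h2)

lemma finrank_EE (N j d : ℕ) :
    Module.finrank ℝ (EE N j d) = (idx (d + 1 - 2 * (N + j + 1))).card +
      Module.finrank ℝ (VV N j (d + 1 - (N + j + 1))) := by
  let ψ : EE N j d →ₗ[ℝ] R2 :=
    (LinearMap.fst ℝ R2 R2 + LinearMap.snd ℝ R2 R2).comp (EE N j d).subtype
  have hψ : ∀ x, ψ x = x.1.1 + x.1.2 := fun x => rfl
  have h1 := LinearMap.finrank_range_add_finrank_ker ψ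
  have h2 : LinearMap.range ψ =
      (VV N j (d + 1 - (N + j + 1))).map (LinearMap.mulLeft ℝ (PhL N (N + j + 1))) := by
    ext p
    constructor
    · rintro ⟨x, rfl⟩
      obtain ⟨-, -, Q, hQ, h⟩ := EE_data x.2
      exact ⟨Q, hQ, by rw [hψ, h]; rfl⟩
    · rintro ⟨Q, hQ, rfl⟩
      obtain ⟨x, hx, h⟩ := VV_lift hQ
      exact ⟨⟨x, hx⟩, by rw [hψ, h]; rfl⟩
  let κ : R2 →ₗ[ℝ] R2 × R2 :=
    (LinearMap.mulLeft ℝ (PhX 0 (N + j + 1) * PhX 1 (N + j + 1))).prod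
      (-(LinearMap.mulLeft ℝ (PhX 0 (N + j + 1) * PhX 1 (N + j + 1))))
  have hκ : Function.Injective κ := by
    intro a b hab
    exact mulLeft_inj (mul_ne_zero (PhX_ne _ _) (PhX_ne _ _)) (congrArg Prod.fst hab)
  have h3 : (LinearMap.ker ψ).map (EE N j d).subtype = (PP (d + 1 - 2 * (N + j + 1))).map κ := by
    ext x
    constructor
    · rintro ⟨x, hx, rfl⟩
      rw [SetLike.mem_coe, LinearMap.mem_ker, hψ] at hx
      obtain ⟨g, hg, h⟩ := EE_ker x.2 hx
      refine ⟨g, hg, Prod.ext h.symm ?_⟩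
      have : x.1.2 = - x.1.1 := eq_neg_of_add_eq_zero_right hx
      change -(_ * g) = x.1.2
      rw [this, h]
    · rintro ⟨g, hg, rfl⟩
      have hm : PhX 0 (N + j + 1) * PhX 1 (N + j + 1) * g ∈ PP (d + 1) := by
        by_cases hc : d + 1 ≤ 2 * (N + j + 1)
        · rw [Nat.sub_eq_zero_of_le hc] at hg
          simp [PP_zero hg]
        · have hd : (PhX 0 (N + j + 1) * PhX 1 (N + j + 1)).totalDegree ≤ 2 * (N + j + 1) := by
            refine (totalDegree_mul _ _).trans ?_
            rw [PhX_deg, PhX_deg]; omega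
          have := mul_mem_PP hd hg
          rwa [Nat.add_sub_cancel' (by omega)] at this
      have hE : κ g ∈ EE N j d := by
        refine ⟨hm, neg_mem hm, fun u hu => ⟨?_, ?_, ?_⟩⟩
        · exact ((Finset.dvd_prod_of_mem _ (Finset.mem_range.2 hu)).mul_right _).mul_right _
        · refine (dvd_neg.2 ?_)
          exact ((Finset.dvd_prod_of_mem _ (Finset.mem_range.2 hu)).mul_left _).mul_right _
        · have h00 : (κ g).1 + (κ g).2 = 0 :=
            add_neg_cancel (PhX 0 (N + j + 1) * PhX 1 (N + j + 1) * g)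
          rw [h00]
          exact dvd_zero _
      refine ⟨⟨κ g, hE⟩, ?_, rfl⟩
      rw [SetLike.mem_coe, LinearMap.mem_ker, hψ]
      exact add_neg_cancel _
  have h4 : Module.finrank ℝ (LinearMap.ker ψ) = (idx (d + 1 - 2 * (N + j + 1))).card := by
    rw [← finrank_PP, ← finrank_map_of_inj _ hκ, ← h3,
      finrank_map_of_inj _ (EE N j d).injective_subtype]
  rw [h2, finrank_map_of_inj _ (mulLeft_inj (PhL_ne _ _))] at h1
  omega

lemma EE_eq_bot (N j d : ℕ) (hd : d < 2 * N + j + 1) (hj : j ≤ N) (x : R2 × R2)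
    (hx : x ∈ EE N j d) : x = 0 := by
  obtain ⟨-, -, Q, hQ, h⟩ := EE_data hx
  have hQ0 : Q = 0 := by
    obtain ⟨c, hc⟩ := nwMap_surj N (PP_mono (n' := N) (by omega) hQ.1)
    have h0 : c = 0 := by
      ext p
      exact nwMap_zero (idx N) c N (by rw [hc]; exact hQ.2.1) p (mem_idx.1 p.2)
    rw [← hc, h0, map_zero]
  rw [hQ0, mul_zero] at h
  obtain ⟨g, hg, h1⟩ := EE_ker hx h
  rw [Nat.sub_eq_zero_of_le (by omega)] at hg
  rw [PP_zero hg, mul_zero] at h1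
  rw [h1, zero_add] at h
  exact Prod.ext h1 h
def DD (N : ℕ) : S →ₐ[ℝ] R2 := aeval ![C (N : ℝ) - X 0, C (N : ℝ) - X 1, 1]

@[simp] lemma DD_X0 (N : ℕ) : DD N (X 0) = C (N : ℝ) - X 0 := by simp [DD]
@[simp] lemma DD_X1 (N : ℕ) : DD N (X 1) = C (N : ℝ) - X 1 := by simp [DD]
@[simp] lemma DD_X2 (N : ℕ) : DD N (X 2) = 1 := by simp [DD]
@[simp] lemma DD_C (N : ℕ) (r : ℝ) : DD N (C r) = C r := by
  simp [DD, MvPolynomial.algebraMap_eq]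

lemma DD_deg (N : ℕ) {F : S} {d : ℕ} (hF : F.IsHomogeneous d) : DD N F ∈ PP (d + 1) := by
  refine mem_PP.2 (Or.inr (Nat.lt_succ_of_le ?_))
  rw [DD, aeval_def, eval₂_eq']
  refine totalDegree_finsetSum_le fun m hm => ?_
  have hm' := hF.degree_eq_sum_deg_support hm
  have hdeg : m 0 + m 1 + m 2 = d := by
    have h : m.degree = d := hm'.symm
    rw [← h, Finsupp.degree_eq_sum, Fin.sum_univ_three]
  have hU : ∀ i : Fin 2, ∀ a : ℕ, ((C (N : ℝ) - X i : R2) ^ a).totalDegree ≤ a := by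
    intro i a
    refine (totalDegree_pow _ _).trans ?_
    have : (C (N : ℝ) - X i : R2).totalDegree ≤ 1 := (totalDegree_sub _ _).trans (by rw [totalDegree_C, totalDegree_X]; simp)
    exact (Nat.mul_le_mul_left a this).trans (by simp)
  have e2 : (![C (N : ℝ) - X 0, C (N : ℝ) - X 1, 1] : Fin 3 → R2) 2 = 1 := rfl
  simp only [Fin.prod_univ_three, e2, Matrix.cons_val_zero, Matrix.cons_val_one, one_pow, mul_one]
  have h1 := totalDegree_mul (algebraMap ℝ R2 (coeff m F))
    ((C (N : ℝ) - X 0 : R2) ^ (m 0) * (C (N : ℝ) - X 1 : R2) ^ (m 1))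
  have h2 := totalDegree_mul ((C (N : ℝ) - X 0 : R2) ^ (m 0)) ((C (N : ℝ) - X 1 : R2) ^ (m 1))
  have h3 := hU 0 (m 0)
  have h4 := hU 1 (m 1)
  have h5 : (algebraMap ℝ R2 (coeff m F)).totalDegree = 0 := by
    rw [MvPolynomial.algebraMap_eq, totalDegree_C]
  omega

lemma eval_homog {F : S} {d : ℕ} (hF : F.IsHomogeneous d) (c : ℝ) (x : Fin 3 → ℝ) :
    eval (fun i => c * x i) F = c ^ d * eval x F := by
  rw [eval_eq', eval_eq', Finset.mul_sum]
  refine Finset.sum_congr rfl fun m hm => ?_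
  have hm' := hF.degree_eq_sum_deg_support hm
  have hdeg : m 0 + m 1 + m 2 = d := by
    have h : m.degree = d := hm'.symm
    rw [← h, Finsupp.degree_eq_sum, Fin.sum_univ_three]
  simp only [Fin.prod_univ_three]
  rw [← hdeg]
  ring

lemma DD_inj (N : ℕ) {F : S} {d : ℕ} (hF : F.IsHomogeneous d) (h : DD N F = 0) : F = 0 := by
  have hev : ∀ a b : ℝ, eval ![a, b, 1] F = 0 := by
    intro a b
    have : (aeval ![(N : ℝ) - a, (N : ℝ) - b] : R2 →ₐ[ℝ] ℝ).comp (DD N) = aeval ![a, b, 1] := by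
      ext i
      fin_cases i <;> simp
    have h2 := DFunLike.congr_fun this F
    rw [AlgHom.comp_apply, h, map_zero] at h2
    simpa [coe_aeval_eq_eval] using h2.symm
  have hz : X 2 * F = 0 := by
    apply MvPolynomial.funext
    intro x
    rw [map_mul, eval_X, map_zero]
    by_cases hx : x 2 = 0
    · rw [hx, zero_mul]
    · have h1 := eval_homog hF (x 2) ![x 0 / x 2, x 1 / x 2, 1]
      rw [hev, mul_zero] at h1
      have h2 : (fun i => x 2 * (![x 0 / x 2, x 1 / x 2, 1] : Fin 3 → ℝ) i) = x := by
        ext i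
        fin_cases i
        · simp; field_simp
        · simp; field_simp
        · simp
      rw [h2] at h1
      rw [h1, mul_zero]
  exact (mul_eq_zero.1 hz).resolve_left (X_ne_zero 2)

lemma DD_inj' (N : ℕ) {F G : S} {d : ℕ} (hF : F.IsHomogeneous d) (hG : G.IsHomogeneous d)
    (h : DD N F = DD N G) : F = G := by
  rw [← sub_eq_zero]
  exact DD_inj N (hF.sub hG) (by rw [map_sub, h, sub_self])

lemma DD_surj (N d : ℕ) {p : R2} (hp : p ∈ PP (d + 1)) :
    ∃ F : S, F.IsHomogeneous d ∧ DD N F = p := by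
  have hsub : ∀ m ∈ p.support, m 0 + m 1 ≤ d := by
    intro m hm
    have := ((mem_restrictSupport_iff ℝ).1 hp) (Finset.mem_coe.2 hm)
    simp only [Set.mem_ofPred_eq, Finsupp.degree_eq_sum, Fin.sum_univ_two] at this
    omega
  refine ⟨∑ m ∈ p.support, C (coeff m p) * ((C (N : ℝ) * X 2 - X 0) ^ (m 0) *
    (C (N : ℝ) * X 2 - X 1) ^ (m 1) * X 2 ^ (d - (m 0 + m 1))), ?_, ?_⟩
  · apply IsHomogeneous.sum
    intro m hm
    have h := hsub m hm
    have hl : ∀ i : Fin 3, (C (N : ℝ) * X 2 - X i : S).IsHomogeneous 1 := fun i =>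
      (isHomogeneous_C_mul_X _ _).sub (isHomogeneous_X _ _)
    have h1 := (((hl 0).pow (m 0)).mul ((hl 1).pow (m 1))).mul
      ((isHomogeneous_X ℝ (2 : Fin 3)).pow (d - (m 0 + m 1)))
    have h2 : 1 * m 0 + 1 * m 1 + 1 * (d - (m 0 + m 1)) = d := by omega
    rw [h2] at h1
    exact h1.C_mul _
  · have : p = ∑ m ∈ p.support, C (coeff m p) * (X 0 ^ (m 0) * X 1 ^ (m 1)) := by
      conv_lhs => rw [p.as_sum]
      refine Finset.sum_congr rfl fun m _ => ?_
      rw [monomial_eq, Finsupp.prod_fintype _ _ (by simp), Fin.prod_univ_two]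
    conv_rhs => rw [this]
    rw [map_sum]
    refine Finset.sum_congr rfl fun m _ => ?_
    simp

lemma homog_factor {f g : S} {n D : ℕ} (hf : f.IsHomogeneous n) (h : (f * g).IsHomogeneous D) :
    ∃ g' : S, f * g = f * g' ∧ g'.IsHomogeneous (D - n) ∧ (n ≤ D ∨ g' = 0) := by
  have hs : f * g = ∑ i ∈ Finset.range (g.totalDegree + 1), f * homogeneousComponent i g := by
    rw [← Finset.mul_sum, sum_homogeneousComponent]
  have hc : f * g = ∑ i ∈ Finset.range (g.totalDegree + 1),
      if n + i = D then f * homogeneousComponent i g else 0 := by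
    conv_lhs => rw [← homogeneousComponent_eq_self ((mem_homogeneousSubmodule _ _).2 h), hs, map_sum]
    refine Finset.sum_congr rfl fun i _ => ?_
    have h1 : f * homogeneousComponent i g ∈ homogeneousSubmodule (Fin 3) ℝ (n + i) :=
      (mem_homogeneousSubmodule _ _).2 (hf.mul (homogeneousComponent_isHomogeneous i g))
    rw [homogeneousComponent_of_mem h1]
    simp [eq_comm]
  by_cases hn : n ≤ D
  · refine ⟨homogeneousComponent (D - n) g, ?_, homogeneousComponent_isHomogeneous _ _, Or.inl hn⟩
    rw [hc, Finset.sum_eq_single (D - n)]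
    · rw [if_pos (by omega)]
    · intro i _ hi
      rw [if_neg (by omega)]
    · intro hi
      rw [homogeneousComponent_eq_zero, mul_zero, ite_self]
      rw [Finset.mem_range] at hi
      omega
  · refine ⟨0, ?_, isHomogeneous_zero _ _ _, Or.inr rfl⟩
    rw [hc, mul_zero]
    apply Finset.sum_eq_zero
    intro i _
    rw [if_neg (by omega)]

lemma mkDer_eq (v : Fin 3 → S) (F : S) : mkDerivation ℝ v F = ∑ i, v i * pderiv i F := by
  have : mkDerivation ℝ v = ∑ i, v i • (pderiv i : Derivation ℝ S S) := by
    apply derivation_ext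
    intro i
    fin_cases i <;> simp [Fin.sum_univ_three, pderiv_X]
  rw [this, Fin.sum_univ_three, Fin.sum_univ_three]
  simp

lemma der_homog (v : Fin 3 → S) (d n : ℕ) (hv : ∀ i, (v i).IsHomogeneous d) {F : S}
    (hF : F.IsHomogeneous n) : (mkDerivation ℝ v F).IsHomogeneous (d + (n - 1)) := by
  rw [mkDer_eq]
  exact IsHomogeneous.sum _ _ _ fun i _ => (hv i).mul hF.pderiv

lemma euler_apply {F : S} {n : ℕ} (hF : F.IsHomogeneous n) :
    mkDerivation ℝ (X : Fin 3 → S) F = n • F := by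
  rw [mkDer_eq]
  exact hF.sum_X_mul_pderiv

lemma der_dvd_mul (θ : Derivation ℝ S S) {a b : S} (ha : a ∣ θ a) (hb : b ∣ θ b) :
    a * b ∣ θ (a * b) := by
  rw [Derivation.leibniz, smul_eq_mul, smul_eq_mul]
  obtain ⟨c, hc⟩ := ha
  obtain ⟨e, he⟩ := hb
  exact ⟨e + c, by rw [hc, he]; ring⟩

lemma der_dvd_prod {ι : Type*} (θ : Derivation ℝ S S) (s : Finset ι) (a : ι → S)
    (h : ∀ i ∈ s, a i ∣ θ (a i)) : (∏ i ∈ s, a i) ∣ θ (∏ i ∈ s, a i) := by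
  classical
  induction s using Finset.induction_on with
  | empty => simp
  | insert i s hi ih =>
    rw [Finset.prod_insert hi]
    exact der_dvd_mul θ (h i (Finset.mem_insert_self _ _))
      (ih fun i' hi' => h i' (Finset.mem_insert_of_mem hi'))

lemma dvd_theta (θ : Derivation ℝ S S) {f α h : S} (h0 : θ f = 0) (hf : f = α * h)
    (g : Fin 3 → S) (hg : ∀ i, α ∣ X i - g i) (hα : aeval g α = 0) (x : Fin 3 → ℝ)
    (hx : ∀ i, eval x (g i) = x i) (hh : eval x h ≠ 0) : α ∣ θ α := by
  refine dvd_of_subst g hg hα x hx hh ?_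
  rw [hf, Derivation.leibniz, smul_eq_mul, smul_eq_mul] at h0
  exact ⟨-θ h, by linear_combination h0⟩

section factors
variable (j k : ℕ)

lemma fjk_homog : ∃ n, 1 ≤ n ∧ (fjk j k).IsHomogeneous n := by
  refine ⟨1 + ∑ s ∈ Finset.Icc (-(j : ℤ)) ((k : ℤ) + j), (1 + 1 + 1), by omega, ?_⟩
  refine (isHomogeneous_X _ _).mul (IsHomogeneous.prod _ _ _ fun s _ => ?_)
  have h2 := isHomogeneous_C_mul_X (s : ℝ) (2 : Fin 3)
  have h0 := isHomogeneous_X ℝ (0 : Fin 3)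
  have h1 := isHomogeneous_X ℝ (1 : Fin 3)
  exact ((h0.sub h2).mul (h1.sub h2)).mul ((h0.add h1).sub h2)

lemma theta_z (θ : Derivation ℝ S S) (h0 : θ (fjk j k) = 0) : X 2 ∣ θ (X 2) := by
  refine dvd_theta θ h0 rfl ![X 0, X 1, 0] ?_ (by simp) ![1, 1, 0] ?_ ?_
  · intro i; fin_cases i <;> simp
  · intro i; fin_cases i <;> simp
  · rw [map_prod]
    refine Finset.prod_ne_zero_iff.2 fun s _ => ?_
    simp

lemma fjk_split {s : ℤ} (hs : s ∈ Finset.Icc (-(j : ℤ)) ((k : ℤ) + j)) :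
    fjk j k = (X 0 - C (s : ℝ) * X 2) * (X 1 - C (s : ℝ) * X 2) * (X 0 + X 1 - C (s : ℝ) * X 2) *
      (X 2 * ∏ s ∈ (Finset.Icc (-(j : ℤ)) ((k : ℤ) + j)).erase s,
    ((X 0 - C (s : ℝ) * X 2) * (X 1 - C (s : ℝ) * X 2) * (X 0 + X 1 - C (s : ℝ) * X 2))) := by
  rw [fjk, ← Finset.mul_prod_erase _ _ hs]
  ring

lemma rest_ne {s : ℤ} (x y : ℝ)
    (h : ∀ t ∈ Finset.Icc (-(j : ℤ)) ((k : ℤ) + j), t ≠ s →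
      x - t ≠ 0 ∧ y - t ≠ 0 ∧ x + y - t ≠ 0) :
    eval ![x, y, 1] (X 2 * ∏ s ∈ (Finset.Icc (-(j : ℤ)) ((k : ℤ) + j)).erase s,
    ((X 0 - C (s : ℝ) * X 2) * (X 1 - C (s : ℝ) * X 2) * (X 0 + X 1 - C (s : ℝ) * X 2)) : S) ≠ 0 := by
  rw [map_mul, map_prod]
  refine mul_ne_zero (by simp) (Finset.prod_ne_zero_iff.2 fun t ht => ?_)
  rw [Finset.mem_erase] at ht
  obtain ⟨h1, h2, h3⟩ := h t ht.2 ht.1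
  simp [h1, h2, h3]

lemma theta_x (θ : Derivation ℝ S S) (h0 : θ (fjk j k) = 0) {s : ℤ}
    (hs : s ∈ Finset.Icc (-(j : ℤ)) ((k : ℤ) + j)) :
    (X 0 - C (s : ℝ) * X 2) ∣ θ (X 0 - C (s : ℝ) * X 2) := by
  have hb : ∀ t ∈ Finset.Icc (-(j : ℤ)) ((k : ℤ) + j), -(j : ℝ) ≤ t ∧ (t : ℝ) ≤ k + j := by
    intro t ht
    rw [Finset.mem_Icc] at ht
    exact ⟨by exact_mod_cast ht.1, by exact_mod_cast ht.2⟩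
  have hj : (0 : ℝ) ≤ j := Nat.cast_nonneg j
  have hk : (0 : ℝ) ≤ k := Nat.cast_nonneg k
  have hf := fjk_split j k hs
  rw [mul_assoc, mul_assoc] at hf
  have hs' := hb s hs
  refine dvd_theta θ h0 hf ![C (s : ℝ) * X 2, X 1, X 2] ?_ (by simp [MvPolynomial.algebraMap_eq])
    ![(s : ℝ), 3 * (k + j) + 1, 1] ?_ ?_
  · intro i; fin_cases i <;> simp
  · intro i; fin_cases i <;> simp
  · rw [map_mul, map_mul]
    refine mul_ne_zero ?_ (mul_ne_zero ?_ (rest_ne j k _ _ ?_))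
    · simp; intro h; linarith
    · simp; intro h; linarith
    · intro t ht hts
      have := hb t ht
      refine ⟨?_, ?_, ?_⟩
      · rw [sub_ne_zero]; exact_mod_cast hts.symm
      · intro h; linarith
      · intro h; linarith

lemma theta_y (θ : Derivation ℝ S S) (h0 : θ (fjk j k) = 0) {s : ℤ}
    (hs : s ∈ Finset.Icc (-(j : ℤ)) ((k : ℤ) + j)) :
    (X 1 - C (s : ℝ) * X 2) ∣ θ (X 1 - C (s : ℝ) * X 2) := by
  have hb : ∀ t ∈ Finset.Icc (-(j : ℤ)) ((k : ℤ) + j), -(j : ℝ) ≤ t ∧ (t : ℝ) ≤ k + j := by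
    intro t ht
    rw [Finset.mem_Icc] at ht
    exact ⟨by exact_mod_cast ht.1, by exact_mod_cast ht.2⟩
  have hj : (0 : ℝ) ≤ j := Nat.cast_nonneg j
  have hk : (0 : ℝ) ≤ k := Nat.cast_nonneg k
  have hf := fjk_split j k hs
  rw [mul_comm (X 0 - _) (X 1 - _), mul_assoc, mul_assoc] at hf
  have hs' := hb s hs
  refine dvd_theta θ h0 hf ![X 0, C (s : ℝ) * X 2, X 2] ?_ (by simp [MvPolynomial.algebraMap_eq])
    ![3 * (k + j) + 1, (s : ℝ), 1] ?_ ?_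
  · intro i; fin_cases i <;> simp
  · intro i; fin_cases i <;> simp
  · rw [map_mul, map_mul]
    refine mul_ne_zero ?_ (mul_ne_zero ?_ (rest_ne j k _ _ ?_))
    · simp; intro h; linarith
    · simp; intro h; linarith
    · intro t ht hts
      have := hb t ht
      refine ⟨?_, ?_, ?_⟩
      · intro h; linarith
      · rw [sub_ne_zero]; exact_mod_cast hts.symm
      · intro h; linarith

lemma theta_xy (θ : Derivation ℝ S S) (h0 : θ (fjk j k) = 0) {s : ℤ}
    (hs : s ∈ Finset.Icc (-(j : ℤ)) ((k : ℤ) + j)) :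
    (X 0 + X 1 - C (s : ℝ) * X 2) ∣ θ (X 0 + X 1 - C (s : ℝ) * X 2) := by
  have hb : ∀ t ∈ Finset.Icc (-(j : ℤ)) ((k : ℤ) + j), -(j : ℝ) ≤ t ∧ (t : ℝ) ≤ k + j := by
    intro t ht
    rw [Finset.mem_Icc] at ht
    exact ⟨by exact_mod_cast ht.1, by exact_mod_cast ht.2⟩
  have hj : (0 : ℝ) ≤ j := Nat.cast_nonneg j
  have hk : (0 : ℝ) ≤ k := Nat.cast_nonneg k
  have hf := fjk_split j k hs
  rw [mul_comm (_ * _) (X 0 + X 1 - _), mul_assoc] at hf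
  have hs' := hb s hs
  refine dvd_theta θ h0 hf ![X 0, C (s : ℝ) * X 2 - X 0, X 2] ?_
    (by simp [MvPolynomial.algebraMap_eq])
    ![3 * (k + j) + 1, (s : ℝ) - (3 * (k + j) + 1), 1] ?_ ?_
  · intro i
    fin_cases i
    · simp
    · exact ⟨1, by simp; ring⟩
    · simp
  · intro i; fin_cases i <;> simp
  · rw [map_mul, map_mul]
    refine mul_ne_zero (mul_ne_zero ?_ ?_) (rest_ne j k _ _ ?_)
    · simp; intro h; linarith
    · simp; intro h; linarith
    · intro t ht hts
      have := hb t ht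
      refine ⟨?_, ?_, ?_⟩
      · intro h; linarith
      · intro h; linarith
      · have : (s : ℝ) ≠ t := by exact_mod_cast hts.symm
        intro h
        apply this
        linarith

lemma fjk_ne_zero : fjk j k ≠ 0 := by
  have hj : (0 : ℝ) ≤ j := Nat.cast_nonneg j
  have hk : (0 : ℝ) ≤ k := Nat.cast_nonneg k
  refine mul_ne_zero (X_ne_zero _) (Finset.prod_ne_zero_iff.2 fun t ht => ?_)
  rw [Finset.mem_Icc] at ht
  have h2 : (t : ℝ) ≤ k + j := by exact_mod_cast ht.2
  have h1 : eval ![(k + j + 1 : ℝ), (k + j + 1 : ℝ), 1] ((X 0 - C (t : ℝ) * X 2) * (X 1 - C (t : ℝ) * X 2) *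
    (X 0 + X 1 - C (t : ℝ) * X 2) : S) ≠ 0 := by
    rw [map_mul, map_mul]
    refine mul_ne_zero (mul_ne_zero ?_ ?_) ?_
    · simp; intro h; linarith
    · simp; intro h; linarith
    · simp; intro h; linarith
  intro h
  rw [h, map_zero] at h1
  exact h1 rfl

end factors
/-- The comparison map to pairs of bivariate polynomials. -/
def Psi (N : ℕ) : Derivation ℝ S S →ₗ[ℝ] R2 × R2 where
  toFun θ := (DD N (θ (X 0)) - DD N (X 0) * DD N (θ (X 2)),
    DD N (θ (X 1)) - DD N (X 1) * DD N (θ (X 2)))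
  map_add' a b := by
    ext1
    · simp only [Derivation.add_apply, map_add, Prod.fst_add]; ring
    · simp only [Derivation.add_apply, map_add, Prod.snd_add]; ring
  map_smul' c a := by
    ext1
    · simp only [Derivation.smul_apply, map_smul, Prod.smul_fst, RingHom.id_apply, smul_sub,
        mul_smul_comm]
    · simp only [Derivation.smul_apply, map_smul, Prod.smul_snd, RingHom.id_apply, smul_sub,
        mul_smul_comm]

lemma Psi_fst (N : ℕ) (θ : Derivation ℝ S S) :
    (Psi N θ).1 = DD N (θ (X 0)) - (C (N : ℝ) - X 0) * DD N (θ (X 2)) := by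
  rw [← DD_X0]; rfl

lemma Psi_snd (N : ℕ) (θ : Derivation ℝ S S) :
    (Psi N θ).2 = DD N (θ (X 1)) - (C (N : ℝ) - X 1) * DD N (θ (X 2)) := by
  rw [← DD_X1]; rfl

lemma der_lin (θ : Derivation ℝ S S) (F : S) (c : ℝ) :
    θ (F - C c * X 2) = θ F - C c * θ (X 2) := by
  rw [map_sub, ← smul_eq_C_mul, ← smul_eq_C_mul, Derivation.map_smul]

lemma Psi_deg (N d : ℕ) {F H : S} (i : Fin 3) (hF : F.IsHomogeneous d) (hH : H.IsHomogeneous d)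
    (h : X 2 ∣ H) : DD N F - DD N (X i) * DD N H ∈ PP (d + 1) := by
  obtain ⟨g, rfl⟩ := h
  obtain ⟨g', h1, h2, h3⟩ := homog_factor (isHomogeneous_X ℝ 2) hH
  refine sub_mem (DD_deg N hF) ?_
  rw [h1, map_mul, DD_X2, one_mul, ← map_mul]
  rcases h3 with h3 | h3
  · have := (isHomogeneous_X ℝ i).mul h2
    rw [show 1 + (d - 1) = d by omega] at this
    exact DD_deg N this
  · rw [h3, mul_zero, map_zero]
    exact zero_mem _

lemma Psi_mem (k j d : ℕ) {θ : Derivation ℝ S S} (hθ : θ ∈ homogD0 (fjk j k) d) :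
    Psi (k + j) θ ∈ EE (k + j) j d := by
  obtain ⟨h0, hh⟩ := hθ
  have hz := theta_z j k θ h0
  refine ⟨Psi_deg _ _ 0 (hh 0) (hh 2) hz, Psi_deg _ _ 1 (hh 1) (hh 2) hz, fun u hu => ?_⟩
  have hs : ((k + j : ℕ) : ℤ) - u ∈ Finset.Icc (-(j : ℤ)) ((k : ℤ) + j) := by
    rw [Finset.mem_Icc]; push_cast; omega
  have hsc : (((((k + j : ℕ) : ℤ) - u : ℤ)) : ℝ) = ((k + j : ℕ) : ℝ) - u := by push_cast; ring
  have hx := theta_x j k θ h0 hs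
  have hy := theta_y j k θ h0 hs
  have hxy := theta_xy j k θ h0 hs
  rw [hsc, der_lin] at hx hy hxy
  rw [Psi_fst, Psi_snd]
  generalize k + j = N at *
  obtain ⟨a, ha⟩ := hx
  obtain ⟨b, hb⟩ := hy
  obtain ⟨c, hc⟩ := hxy
  have ha' := congrArg (DD N) ha
  have hb' := congrArg (DD N) hb
  have hc' := congrArg (DD N) hc
  simp only [map_sub, map_mul, map_add, DD_X0, DD_X1, DD_X2, DD_C] at ha' hb' hc'
  refine ⟨⟨-DD N a + DD N (θ (X 2)), ?_⟩, ⟨-DD N b + DD N (θ (X 2)), ?_⟩,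
    ⟨-DD N c + DD N (θ (X 2)), ?_⟩⟩
  · linear_combination ha'
  · linear_combination hb'
  · rw [ll]
    push_cast
    rw [map_add]
    linear_combination hc'

lemma Psi_inj (k j d : ℕ) {θ : Derivation ℝ S S} (hθ : θ ∈ homogD0 (fjk j k) d)
    (h : Psi (k + j) θ = 0) : θ = 0 := by
  obtain ⟨h0, hh⟩ := hθ
  have key : ∀ i : Fin 3, X 2 * θ (X i) = θ (X 2) * X i := by
    intro i
    have hom1 : (X 2 * θ (X i)).IsHomogeneous (1 + d) := (isHomogeneous_X ℝ 2).mul (hh i)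
    have hom2 : (θ (X 2) * X i).IsHomogeneous (1 + d) := by
      rw [mul_comm]; exact (isHomogeneous_X ℝ i).mul (hh 2)
    refine DD_inj' (k + j) hom1 hom2 ?_
    have h1 := congrArg Prod.fst h
    have h2 := congrArg Prod.snd h
    rw [Psi_fst, Prod.fst_zero] at h1
    rw [Psi_snd, Prod.snd_zero] at h2
    fin_cases i
    · simp only [Fin.zero_eta, map_mul, DD_X2, DD_X0]
      linear_combination h1
    · simp only [Fin.mk_one, map_mul, DD_X2, DD_X1]
      linear_combination h2
    · simp only [Fin.reduceFinMk, map_mul, DD_X2]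
      ring
  have hder : (X 2 : S) • θ = θ (X 2) • mkDerivation ℝ (X : Fin 3 → S) := by
    apply derivation_ext
    intro i
    simp only [Derivation.smul_apply, smul_eq_mul, mkDerivation_X]
    exact key i
  obtain ⟨n, hn, hf⟩ := fjk_homog j k
  have hF := DFunLike.congr_fun hder (fjk j k)
  simp only [Derivation.smul_apply, smul_eq_mul, h0, mul_zero, euler_apply hf] at hF
  have hz : θ (X 2) = 0 := by
    rcases mul_eq_zero.1 hF.symm with h | h
    · exact h
    · exfalso
      rcases smul_eq_zero.1 h with h | h
      · omega
      · exact fjk_ne_zero j k h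
  apply derivation_ext
  intro i
  have := key i
  rw [hz, zero_mul] at this
  exact (mul_eq_zero.1 this).resolve_left (X_ne_zero 2)

lemma lift_dvd (N d : ℕ) (hd : 1 ≤ d) {P L : S} {l : R2} (hP : P.IsHomogeneous d)
    (hL : L.IsHomogeneous 1) (hl : DD N L = -l) (hl1 : l.totalDegree = 1) (hl0 : l ≠ 0)
    (h : l ∣ DD N P) : L ∣ P := by
  obtain ⟨p, hp⟩ := h
  have hmem : p ∈ PP (d - 1 + 1) := by
    have h1 := DD_deg N hP
    rw [hp] at h1
    have h2 := mem_PP_of_mul hl0 hl1 h1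
    exact PP_mono (by omega) h2
  obtain ⟨G, hG, hGp⟩ := DD_surj N (d - 1) hmem
  refine ⟨-G, DD_inj' N hP ?_ ?_⟩
  · have := hL.mul hG.neg
    rwa [show 1 + (d - 1) = d by omega] at this
  · rw [hp, map_mul, hl, map_neg, hGp]; ring

lemma Psi_surj (k j d : ℕ) (hd : 1 ≤ d) {x : R2 × R2} (hx : x ∈ EE (k + j) j d) :
    ∃ θ ∈ homogD0 (fjk j k) d, Psi (k + j) θ = x := by
  obtain ⟨hp, hq, hdv⟩ := hx
  obtain ⟨P, hP, hPp⟩ := DD_surj (k + j) d hp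
  obtain ⟨Q, hQ, hQq⟩ := DD_surj (k + j) d hq
  let θ' : Derivation ℝ S S := mkDerivation ℝ ![P, Q, 0]
  have t0 : θ' (X 0) = P := by simp [θ', mkDerivation_X]
  have t1 : θ' (X 1) = Q := by simp [θ', mkDerivation_X]
  have t2 : θ' (X 2) = 0 := by simp [θ', mkDerivation_X]
  have hdvd : fjk j k ∣ θ' (fjk j k) := by
    refine der_dvd_mul θ' (by rw [t2]; exact dvd_zero _) (der_dvd_prod θ' _ _ fun s hs => ?_)
    rw [Finset.mem_Icc] at hs
    obtain ⟨u, hu⟩ : ∃ u : ℕ, (u : ℤ) = ((k + j : ℕ) : ℤ) - s :=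
      ⟨(((k + j : ℕ) : ℤ) - s).toNat, by push_cast; omega⟩
    have hul : u < k + j + j + 1 := by push_cast at hu; omega
    have hsu : (s : ℝ) = ((k + j : ℕ) : ℝ) - u := by
      have : ((u : ℤ) : ℝ) = ((((k + j : ℕ) : ℤ) - s : ℤ) : ℝ) := by rw [hu]
      push_cast at this ⊢
      linarith
    obtain ⟨hd0, hd1, hd2⟩ := hdv u hul
    have g2 := isHomogeneous_C_mul_X (s : ℝ) (2 : Fin 3)
    have g0 := isHomogeneous_X ℝ (0 : Fin 3)
    have g1 := isHomogeneous_X ℝ (1 : Fin 3)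
    refine der_dvd_mul θ' (der_dvd_mul θ' ?_ ?_) ?_
    · rw [der_lin, t2, mul_zero, sub_zero, t0]
      refine lift_dvd (k + j) d hd hP (g0.sub g2) (l := X 0 - C (u : ℝ)) ?_
        (totalDegree_X_sub_C' _ _) (X_sub_C_ne_zero' _ _) (by rwa [hPp])
      simp only [map_sub, map_mul, DD_X0, DD_C, DD_X2, hsu]
      ring
    · rw [der_lin, t2, mul_zero, sub_zero, t1]
      refine lift_dvd (k + j) d hd hQ (g1.sub g2) (l := X 1 - C (u : ℝ)) ?_
        (totalDegree_X_sub_C' _ _) (X_sub_C_ne_zero' _ _) (by rwa [hQq])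
      simp only [map_sub, map_mul, DD_X1, DD_C, DD_X2, hsu]
      ring
    · rw [der_lin, t2, mul_zero, sub_zero, map_add, t0, t1]
      refine lift_dvd (k + j) d hd (hP.add hQ) ((g0.add g1).sub g2)
        (l := ll ((k + j + u : ℕ) : ℝ)) ?_
        (totalDegree_X_add_X_sub _) (ll_ne_zero _) (by rwa [map_add, hPp, hQq])
      rw [ll, Nat.cast_add (k + j) u]
      simp only [map_sub, map_mul, map_add, DD_X0, DD_X1, DD_C, DD_X2, hsu]
      ring
  obtain ⟨n, hn, hf⟩ := fjk_homog j k
  obtain ⟨g, hg⟩ := hdvd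
  have hhom : (fjk j k * g).IsHomogeneous (d + (n - 1)) := by
    rw [← hg]
    refine der_homog _ d n ?_ hf
    intro i
    fin_cases i
    · exact hP
    · exact hQ
    · exact isHomogeneous_zero _ _ _
  obtain ⟨g', h1, h2, -⟩ := homog_factor hf hhom
  rw [show d + (n - 1) - n = d - 1 by omega] at h2
  have h3 : (C ((n : ℝ)⁻¹) * g').IsHomogeneous (d - 1) := h2.C_mul _
  set G : S := C ((n : ℝ)⁻¹) * g' with hG
  let θ : Derivation ℝ S S := θ' - G • mkDerivation ℝ (X : Fin 3 → S)
  have hθ : ∀ i, θ (X i) = θ' (X i) - G * X i := by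
    intro i
    simp [θ, mkDerivation_X]
  refine ⟨θ, ⟨?_, ?_⟩, ?_⟩
  · change θ' (fjk j k) - G * (mkDerivation ℝ (X : Fin 3 → S) (fjk j k)) = 0
    rw [hg, h1, euler_apply hf, hG, nsmul_eq_mul]
    have hnn : (C ((n : ℝ)⁻¹) : S) * (n : S) = 1 := by
      rw [← map_natCast (C : ℝ →+* S) n, ← map_mul, inv_mul_cancel₀, map_one]
      exact_mod_cast (by omega : n ≠ 0)
    linear_combination (-fjk j k * g') * hnn
  · intro i
    rw [hθ]
    have h4 := h3.mul (isHomogeneous_X ℝ i)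
    rw [show d - 1 + 1 = d by omega] at h4
    refine IsHomogeneous.sub ?_ h4
    fin_cases i
    · exact t0 ▸ hP
    · exact t1 ▸ hQ
    · exact t2.symm ▸ isHomogeneous_zero _ _ _
  · refine Prod.ext ?_ ?_
    · rw [Psi_fst, hθ, hθ, t0, t2, ← hPp]
      simp only [map_sub, map_mul, map_zero, DD_X0, DD_X2]
      ring
    · rw [Psi_snd, hθ, hθ, t1, t2, ← hQq]
      simp only [map_sub, map_mul, map_zero, DD_X1, DD_X2]
      ring

lemma finrank_homogD0_eq (k j d : ℕ) (hd : 1 ≤ d) :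
    Module.finrank ℝ (homogD0 (fjk j k) d) = Module.finrank ℝ (EE (k + j) j d) := by
  have hinj : Function.Injective ((Psi (k + j)).domRestrict (homogD0 (fjk j k) d)) := by
    refine (injective_iff_map_eq_zero _).2 ?_
    intro θ h
    exact Subtype.ext (Psi_inj k j d θ.2 h)
  rw [← LinearMap.finrank_range_of_inj hinj]
  have : LinearMap.range ((Psi (k + j)).domRestrict (homogD0 (fjk j k) d)) = EE (k + j) j d := by
    apply le_antisymm
    · rintro _ ⟨θ, rfl⟩
      exact Psi_mem k j d θ.2
    · intro x hx
      obtain ⟨θ, h1, h2⟩ := Psi_surj k j d hd hx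
      exact ⟨⟨θ, h1⟩, h2⟩
  rw [this]

lemma dim_arith (k j r e v : ℕ) (hk : 2 ≤ k)
    (he : e = (idx (r - j)).card + v)
    (hv : v + (idx j).card + (idx (k + j)).card =
      (idx (k + j + r + 1)).card + (idx (j - (r + 1))).card) :
    e = (k + 1) * ((r + 2) * (r + 1) / 2) - (k - 1) * ((r + 1) * r / 2) := by
  have c1 : (r + 2) * (r + 1) / 2 = (idx (r + 1)).card := by
    have := two_card_idx (r + 1)
    rw [show (r + 2) * (r + 1) = 2 * (idx (r + 1)).card by rw [this]; ring]
    simp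
  have c2 : (r + 1) * r / 2 = (idx r).card := by
    have := two_card_idx r
    rw [show (r + 1) * r = 2 * (idx r).card by rw [this]; ring]
    simp
  rw [c1, c2]
  obtain ⟨k, rfl⟩ : ∃ k', k = k' + 1 := ⟨k - 1, by omega⟩
  rw [Nat.add_sub_cancel]
  symm
  apply Nat.sub_eq_of_eq_add
  have a1 := two_card_idx (r + 1)
  have a2 := two_card_idx r
  have a3 := two_card_idx j
  have a4 := two_card_idx (k + 1 + j)
  have a5 := two_card_idx (k + 1 + j + r + 1)
  have a6 := two_card_idx (j - (r + 1))
  have a7 := two_card_idx (r - j)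
  clear c1 c2 hk
  qify at *
  rcases lt_or_ge r j with h | h
  · obtain ⟨t, rfl⟩ := Nat.exists_eq_add_of_le h
    rw [show r.succ + t - (r + 1) = t by omega] at *
    rw [show r - (r.succ + t) = 0 by omega] at *
    push_cast at *
    linear_combination -he - hv + (k+2)/2*a1 - k/2*a2+a3/2+a4/2-a5/2-a6/2-a7/2
  · obtain ⟨t, rfl⟩ := Nat.exists_eq_add_of_le h
    rw [Nat.add_sub_cancel_left] at *
    rw [show j - (j + t + 1) = 0 by omega] at *
    push_cast at *
    linear_combination -he - hv + (k+2)/2*a1 - k/2*a2+a3/2+a4/2-a5/2-a6/2-a7/2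

/-- The dimension count for the graded pieces of `D_0(f_{j,k})`: it vanishes in degrees
below `a = 2k+1+3j`, and in degree `d ≥ a` has dimension
`(k+1)(d-a+2)(d-a+1)/2 - (k-1)(d-a+1)(d-a)/2`. -/
theorem finrank_homogD0_of_A2_deformation (k j : ℕ) (hk : 2 ≤ k) :
    (∀ d : ℕ, d < 2 * k + 1 + 3 * j → homogD0 (fjk j k) d = ⊥) ∧
    (∀ d : ℕ, 2 * k + 1 + 3 * j ≤ d →
      Module.finrank ℝ (homogD0 (fjk j k) d) =
        (k + 1) * ((d - (2 * k + 1 + 3 * j) + 2) * (d - (2 * k + 1 + 3 * j) + 1) / 2)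
          - (k - 1) * ((d - (2 * k + 1 + 3 * j) + 1) * (d - (2 * k + 1 + 3 * j)) / 2)) := by
  refine ⟨fun d hd => ?_, fun d hd => ?_⟩
  · rw [Submodule.eq_bot_iff]
    intro θ hθ
    exact Psi_inj k j d hθ
      (EE_eq_bot (k + j) j d (by omega) (by omega) _ (Psi_mem k j d hθ))
  · obtain ⟨r, rfl⟩ := Nat.exists_eq_add_of_le hd
    rw [Nat.add_sub_cancel_left, finrank_homogD0_eq k j _ (by omega)]
    have h1 := finrank_EE (k + j) j (2 * k + 1 + 3 * j + r)
    have h2 := finrank_VV (k + j) j r (by omega)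
    rw [show 2 * k + 1 + 3 * j + r + 1 - 2 * (k + j + j + 1) = r - j by omega,
      show 2 * k + 1 + 3 * j + r + 1 - (k + j + j + 1) = k + j + r + 1 by omega] at h1
    exact dim_arith k j r _ _ hk h1 h2
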